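/- Tail upper bound for Boltzmann-type kernels: let d ≥ 2, s ∈ (0,1), and γ ∈ (−d, 1] with γ + 2s ≤ 2. Let f : ℝ^d → [0,∞] be measurable and, for v ≠ v' in ℝ^d, define the kernel K(v,v') = |v − v'|^{−d−2s} ∫_{(v'−v)^⊥} f(v + w) |w|^{γ+2s+1} dH(w), where dH is the (d−1)-dimensional Hausdorff measure on the hyperplane (v'−v)^⊥ = {w ∈ ℝ^d : w·(v'−v) = 0}. Then there exists a constant C, depending only on d, s and γ, such that for every v' ∈ ℝ^d and every r > 0, ∫_{ℝ^d ∖ B_r(v')} K(v,v') dv ≤ C r^{−2s} ∫_{ℝ^d} f(z) |z − v'|^{γ+2s} dz, as an inequality in [0,∞]. -/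

import Mathlib

open MeasureTheory Metric Set
open scoped ENNReal RealInnerProductSpace

noncomputable section


lemma bk_decomp (n : ℕ) (σ : EuclideanSpace ℝ (Fin (n+1))) (hσ : ‖σ‖ = 1) :
    ∃ J : EuclideanSpace ℝ (Fin n) →ₗᵢ[ℝ] EuclideanSpace ℝ (Fin (n+1)),
      Set.range J = {w | ⟪w, σ⟫ = 0} ∧
      ∀ G : EuclideanSpace ℝ (Fin (n+1)) → ℝ≥0∞, Measurable G →
        ∫⁻ z, G z = ∫⁻ t : ℝ, ∫⁻ y, G (t • σ + J y) := by
  have hon : Orthonormal ℝ (({0} : Set (Fin (n+1))).domRestrict (fun _ => σ)) := by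
    constructor
    · intro i; exact hσ
    · intro i j hij
      exact absurd (Subsingleton.elim i j) hij
  obtain ⟨b, hb⟩ := hon.exists_orthonormalBasis_extension_of_card_eq (by simp)
  have hb0 : b 0 = σ := hb 0 (by simp)
  let Lm : EuclideanSpace ℝ (Fin n) →ₗ[ℝ] EuclideanSpace ℝ (Fin (n+1)) :=
    { toFun := fun y => WithLp.toLp 2 (Fin.cons 0 y.ofLp)
      map_add' := by
        intro x y; ext i; refine Fin.cases ?_ (fun j => ?_) i <;> simp
      map_smul' := by
        intro c y; ext i; refine Fin.cases ?_ (fun j => ?_) i <;> simp }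
  let Li : EuclideanSpace ℝ (Fin n) →ₗᵢ[ℝ] EuclideanSpace ℝ (Fin (n+1)) :=
    { Lm with
      norm_map' := by
        intro y
        simp [Lm, EuclideanSpace.norm_eq, Fin.sum_univ_succ] }
  have hLi : ∀ y, Li y = WithLp.toLp 2 (Fin.cons 0 y.ofLp) := fun y => rfl
  have hrep : ∀ (t : ℝ) y, t • σ + b.repr.symm (Li y) =
      b.repr.symm (WithLp.toLp 2 (Fin.cons t y.ofLp)) := by
    intro t y
    rw [← hb0, ← b.repr_symm_single, ← map_smul, ← map_add]
    congr 1
    ext i; refine Fin.cases ?_ (fun j => ?_) i <;> simp [hLi]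
  refine ⟨b.repr.symm.toLinearIsometry.comp Li, ?_, ?_⟩
  · ext w
    simp only [mem_range, mem_ofPred_eq, LinearIsometry.coe_comp, Function.comp]
    have key : ⟪w, σ⟫ = b.repr w 0 := by
      rw [← hb0, b.repr_apply_apply, real_inner_comm]
    rw [key]
    constructor
    · rintro ⟨y, rfl⟩
      simp [hLi]
    · intro h
      refine ⟨WithLp.toLp 2 (fun i => b.repr w i.succ), ?_⟩
      change b.repr.symm (Li _) = w
      rw [LinearIsometryEquiv.symm_apply_eq]
      ext i; refine Fin.cases ?_ (fun j => ?_) i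
      · simp [hLi, h]
      · simp [hLi]
  · intro G hG
    have e1 : ∫⁻ z, G z = ∫⁻ x, G (b.repr.symm x) :=
      ((b.repr.symm.measurePreserving).lintegral_comp hG).symm
    have hG1 : Measurable fun x => G (b.repr.symm x) :=
      hG.comp b.repr.symm.continuous.measurable
    have e2 : ∫⁻ x, G (b.repr.symm x) = ∫⁻ p : Fin (n+1) → ℝ, G (b.repr.symm (WithLp.toLp 2 p)) :=
      ((PiLp.volume_preserving_toLp (Fin (n+1))).lintegral_comp hG1).symm
    have hG2 : Measurable fun p : Fin (n+1) → ℝ => G (b.repr.symm (WithLp.toLp 2 p)) :=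
      hG1.comp (PiLp.continuous_toLp 2 _).measurable
    have e3 := ((volume_preserving_piFinSuccAbove (fun _ : Fin (n+1) => ℝ) 0).symm).lintegral_comp hG2
    rw [e1, e2, ← e3]
    have hm := hG2.comp (MeasurableEquiv.piFinSuccAbove (fun _ : Fin (n+1) => ℝ) 0).symm.measurable
    rw [Measure.volume_eq_prod]
    refine (lintegral_prod _ hm.aemeasurable).trans ?_
    refine lintegral_congr fun t => ?_
    have hGt : Measurable fun y : EuclideanSpace ℝ (Fin n) => G (t • σ + b.repr.symm (Li y)) := by
      refine hG.comp (Continuous.measurable ?_)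
      have := Li.continuous
      have := b.repr.symm.continuous
      fun_prop
    have e4 := (PiLp.volume_preserving_toLp (Fin n)).lintegral_comp hGt
    change _ = ∫⁻ y, G (t • σ + b.repr.symm (Li y))
    rw [← e4]
    refine lintegral_congr fun y => ?_
    rw [hrep]
    simp [MeasurableEquiv.piFinSuccAbove, Fin.insertNthEquiv]

lemma bk_hausdorff (n : ℕ) : ∃ c : ℝ≥0∞, c ≠ ∞ ∧
    ∀ (σ : EuclideanSpace ℝ (Fin (n+1)))
      (J : EuclideanSpace ℝ (Fin n) →ₗᵢ[ℝ] EuclideanSpace ℝ (Fin (n+1))),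
      Set.range J = {w | ⟪w, σ⟫ = 0} →
      ∀ g : EuclideanSpace ℝ (Fin (n+1)) → ℝ≥0∞,
        ∫⁻ w in {w | ⟪w, σ⟫ = 0}, g w ∂(μH[(n : ℝ)]) = c * ∫⁻ y, g (J y) := by
  have hH : (μH[(n:ℝ)] : Measure (EuclideanSpace ℝ (Fin n))).IsAddHaarMeasure := by
    simpa using MeasureTheory.isAddHaarMeasure_hausdorffMeasure (E := EuclideanSpace ℝ (Fin n))
  refine ⟨Measure.addHaarScalarFactor (μH[(n:ℝ)] : Measure (EuclideanSpace ℝ (Fin n))) volume,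
    by simp, ?_⟩
  intro σ J hJ g
  rw [← hJ, ← J.isometry.map_hausdorffMeasure (Or.inl (by positivity)),
    J.isometry.isClosedEmbedding.measurableEmbedding.lintegral_map]
  conv_lhs => rw [Measure.isAddLeftInvariant_eq_smul (μH[(n:ℝ)] : Measure (EuclideanSpace ℝ (Fin n))) volume]
  rw [lintegral_smul_measure]
  rfl

lemma bk_polar_eq (n : ℕ) (H : EuclideanSpace ℝ (Fin (n+1)) → ℝ≥0∞) :
    ∫⁻ x, H x = ∫⁻ p : sphere (0 : EuclideanSpace ℝ (Fin (n+1))) 1 × Ioi (0:ℝ),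
      H (p.2.1 • p.1.1) ∂((volume : Measure (EuclideanSpace ℝ (Fin (n+1)))).toSphere.prod
        (Measure.volumeIoiPow n)) := by
  have h := (volume : Measure (EuclideanSpace ℝ (Fin (n+1)))).measurePreserving_homeomorphUnitSphereProd
  simp only [finrank_euclideanSpace, Fintype.card_fin, Nat.add_sub_cancel] at h
  have h2 := (h.symm (e := (homeomorphUnitSphereProd (EuclideanSpace ℝ (Fin (n+1)))).toMeasurableEquiv)).lintegral_comp_emb
    (MeasurableEquiv.measurableEmbedding _) (fun x => H x.1)
  rw [lintegral_subtype_comap (measurableSet_singleton _).compl] at h2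
  have h3 : ∫⁻ x, H x = ∫⁻ x in ({0}ᶜ : Set (EuclideanSpace ℝ (Fin (n+1)))), H x := by
    rw [restrict_compl_singleton]
  rw [h3, ← h2]
  rfl

lemma bk_radial (n : ℕ) (h : ℝ → ℝ≥0∞) :
    ∫⁻ ρ : Ioi (0:ℝ), h ρ.1 ∂(Measure.volumeIoiPow n) =
      ∫⁻ ρ in Ioi (0:ℝ), ENNReal.ofReal (ρ ^ n) * h ρ := by
  rw [Measure.volumeIoiPow, lintegral_withDensity_eq_lintegral_mul_non_measurable]
  · exact lintegral_subtype_comap measurableSet_Ioi (fun ρ => ENNReal.ofReal (ρ ^ n) * h ρ)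
  · fun_prop
  · simp

lemma bk_ball (n : ℕ) (hn : 1 ≤ n) (β : ℝ) (hβ : -(n:ℝ) < β) :
    ∫⁻ y in ball (0 : EuclideanSpace ℝ (Fin n)) 2, ENNReal.ofReal (‖y‖ ^ β) ≠ ∞ := by
  have : Nonempty (Fin n) := ⟨⟨0, hn⟩⟩
  have h : IntegrableOn (fun y : EuclideanSpace ℝ (Fin n) => ‖y‖ ^ β) (ball 0 2) := by
    rw [integrableOn_fun_norm_addHaar volume (f := fun t : ℝ => t ^ β)]
    simp only [finrank_euclideanSpace, Fintype.card_fin]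
    have h1 : IntegrableOn (fun t : ℝ => t ^ ((n:ℝ) - 1 + β)) (Ioo 0 2) := by
      rw [intervalIntegral.integrableOn_Ioo_rpow_iff (by norm_num)]
      linarith
    refine h1.congr_fun (fun t ht => ?_) measurableSet_Ioo
    have : (0:ℝ) < t := ht.1
    simp only [smul_eq_mul]
    rw [Real.rpow_add this, ← Real.rpow_natCast, Nat.cast_sub hn]; simp
  have := h.hasFiniteIntegral
  rw [hasFiniteIntegral_iff_ofReal] at this
  · exact this.ne
  · exact Filter.Eventually.of_forall fun y => by positivity

lemma bk_tail (s a : ℝ) (hs : 0 < s) (ha : 0 < a) :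
    ∫⁻ t in Ici a, ENNReal.ofReal (t ^ (-1 - 2 * s)) = ENNReal.ofReal (a ^ (-(2*s)) / (2*s)) := by
  rw [setLIntegral_congr Ioi_ae_eq_Ici.symm, ← ofReal_integral_eq_lintegral_ofReal
    (integrableOn_Ioi_rpow_of_lt (by linarith) ha), integral_Ioi_rpow_of_lt (by linarith) ha]
  · congr 1
    rw [show -1 - 2 * s + 1 = -(2*s) by ring, neg_div_neg_eq]
  · filter_upwards [ae_restrict_mem measurableSet_Ioi] with t ht
    have : 0 < t := ha.trans ht
    simp only [Pi.zero_apply]; positivity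

/-- The angular kernel. -/
def bkKer (n : ℕ) (s β r : ℝ) (z σ : EuclideanSpace ℝ (Fin (n+1))) : ℝ≥0∞ :=
  if r ≤ ⟪z, σ⟫ then
    ENNReal.ofReal (⟪z, σ⟫ ^ (-1 - 2 * s)) * ENNReal.ofReal (‖z - ⟪z, σ⟫ • σ‖ ^ β) else 0

lemma bkKer_measurable (n : ℕ) (s β r : ℝ) :
    Measurable fun p : EuclideanSpace ℝ (Fin (n+1)) × EuclideanSpace ℝ (Fin (n+1)) =>
      bkKer n s β r p.1 p.2 := by
  unfold bkKer
  refine Measurable.ite (measurableSet_le measurable_const (by fun_prop)) (Measurable.mul (M := ℝ≥0∞) ?_ ?_) measurable_const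
  · exact ((by fun_prop : Measurable fun p : EuclideanSpace ℝ (Fin (n+1)) × EuclideanSpace ℝ (Fin (n+1)) => ⟪p.1, p.2⟫).pow_const _).ennreal_ofReal
  · exact ((Continuous.measurable (by fun_prop) : Measurable fun p : EuclideanSpace ℝ (Fin (n+1)) × EuclideanSpace ℝ (Fin (n+1)) => ‖p.1 - ⟪p.1, p.2⟫ • p.2‖).pow_const _).ennreal_ofReal

lemma bk_pointwise (n : ℕ) (s γ r ζ t : ℝ) (hr : 0 < r) (hζ : 0 < ζ)
    (e w : EuclideanSpace ℝ (Fin (n+1))) (he : ‖e‖ = 1) (hw : ⟪w, e⟫ = 0)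
    (h1 : 1 < ‖t • e + w‖) (h2 : ‖t • e + w‖ < 2) :
    bkKer n s (γ + 2 * s + 1) r (ζ • e) (‖t • e + w‖⁻¹ • (t • e + w)) ≤
      ENNReal.ofReal (2 ^ |γ| * ζ ^ γ) *
        ((Ici (r / ζ)).indicator (fun t => ENNReal.ofReal (t ^ (-1 - 2 * s))) t *
          (if ‖w‖ < 2 then ENNReal.ofReal (‖w‖ ^ (γ + 2 * s + 1)) else 0)) := by
  have hee : ⟪e, e⟫ = 1 := by rw [real_inner_self_eq_norm_sq, he]; norm_num
  have hew : ⟪e, w⟫ = 0 := by rw [real_inner_comm]; exact hw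
  set X := ‖t • e + w‖ with hX
  have hX0 : 0 < X := by linarith
  have hXsq : X ^ 2 = t ^ 2 + ‖w‖ ^ 2 := by
    rw [hX, norm_add_sq_real, inner_smul_left, hew, norm_smul, he]
    simp
  have hin : ⟪ζ • e, X⁻¹ • (t • e + w)⟫ = ζ * t / X := by
    rw [inner_smul_left, inner_smul_right, inner_add_right, inner_smul_right, hee, hew]
    simp; field_simp
  have hnorm : ‖ζ • e - (ζ * t / X) • X⁻¹ • (t • e + w)‖ = ζ * ‖w‖ / X := by
    rw [← sq_eq_sq₀ (by positivity) (by positivity)]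
    have hvec : ζ • e - (ζ * t / X) • X⁻¹ • (t • e + w) =
        (ζ - ζ * t ^ 2 / X ^ 2) • e - (ζ * t / X ^ 2) • w := by
      module
    rw [hvec, norm_sub_sq_real, inner_smul_left, inner_smul_right, hew, norm_smul, norm_smul, he]
    simp only [mul_pow, Real.norm_eq_abs, sq_abs, div_pow]
    have : ‖w‖ ^ 2 = X ^ 2 - t ^ 2 := by linarith
    simp only [this]
    field_simp
    ring
  unfold bkKer
  rw [hin, hnorm]
  split_ifs with hc hw2
  · have ht : r / ζ ≤ t := by
      rw [div_le_iff₀ hζ]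
      rw [le_div_iff₀ hX0] at hc
      nlinarith
    have ht0 : 0 < t := lt_of_lt_of_le (by positivity) ht
    rw [indicator_of_mem (by exact ht), ← ENNReal.ofReal_mul (by positivity),
      ← ENNReal.ofReal_mul (by positivity), ← ENNReal.ofReal_mul (by positivity)]
    apply ENNReal.ofReal_le_ofReal
    have hXγ : X ^ (-γ) ≤ 2 ^ |γ| := by
      calc X ^ (-γ) ≤ X ^ |γ| := Real.rpow_le_rpow_of_exponent_le h1.le (neg_le_abs γ)
        _ ≤ 2 ^ |γ| := Real.rpow_le_rpow hX0.le h2.le (abs_nonneg _)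
    have e1 : (ζ * t / X) ^ (-1 - 2 * s) * (ζ * ‖w‖ / X) ^ (γ + 2 * s + 1) =
        X ^ (-γ) * (ζ ^ γ * (t ^ (-1 - 2 * s) * ‖w‖ ^ (γ + 2 * s + 1))) := by
      rw [Real.div_rpow (by positivity) hX0.le, Real.div_rpow (by positivity) hX0.le,
        Real.mul_rpow hζ.le ht0.le, Real.mul_rpow hζ.le (norm_nonneg _)]
      have a1 : X ^ (-γ) = (X ^ (-1 - 2 * s))⁻¹ * (X ^ (γ + 2 * s + 1))⁻¹ := by
        rw [← Real.rpow_neg hX0.le, ← Real.rpow_neg hX0.le, ← Real.rpow_add hX0]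
        congr 1; ring
      have a2 : ζ ^ γ = ζ ^ (-1 - 2 * s) * ζ ^ (γ + 2 * s + 1) := by
        rw [← Real.rpow_add hζ]
        congr 1; ring
      rw [a1, a2]
      simp only [div_eq_mul_inv]
      ring
    rw [e1, mul_assoc]
    exact mul_le_mul_of_nonneg_right hXγ (by positivity)
  · exfalso
    apply hw2
    have : ‖w‖ ≤ X := by
      rw [← sq_le_sq₀ (norm_nonneg _) hX0.le]; nlinarith [sq_nonneg t]
    linarith
  · exact zero_le
  · exact zero_le

lemma bk_angular (n : ℕ) (hn : 1 ≤ n) (s γ : ℝ) (hs : 0 < s)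
    (hβ : -(n:ℝ) < γ + 2 * s + 1) :
    ∃ C : ℝ≥0∞, C ≠ ∞ ∧ ∀ (r : ℝ), 0 < r → ∀ z : EuclideanSpace ℝ (Fin (n+1)),
      ∫⁻ σ : sphere (0 : EuclideanSpace ℝ (Fin (n+1))) 1, bkKer n s (γ + 2 * s + 1) r z σ.1
        ∂((volume : Measure (EuclideanSpace ℝ (Fin (n+1)))).toSphere)
      ≤ C * ENNReal.ofReal (r ^ (-(2 * s)) * ‖z‖ ^ (γ + 2 * s)) := by
  set M := ∫⁻ y in ball (0 : EuclideanSpace ℝ (Fin n)) 2, ENNReal.ofReal (‖y‖ ^ (γ + 2 * s + 1)) with hM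
  have hMf : M ≠ ∞ := bk_ball n hn _ hβ
  refine ⟨ENNReal.ofReal (2 ^ |γ| / (2 * s)) * M, ENNReal.mul_ne_top (by simp) hMf, ?_⟩
  intro r hr z
  rcases eq_or_ne z 0 with rfl | hz
  · have : ∀ σ : sphere (0 : EuclideanSpace ℝ (Fin (n+1))) 1,
        bkKer n s (γ + 2 * s + 1) r 0 σ.1 = 0 := by
      intro σ; simp [bkKer, hr]
    simp [this]
  have hζ : 0 < ‖z‖ := norm_pos_iff.mpr hz
  set e := ‖z‖⁻¹ • z with hedef
  have he : ‖e‖ = 1 := by rw [hedef, norm_smul]; simp; field_simp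
  have hze : z = ‖z‖ • e := by rw [hedef, smul_smul, mul_inv_cancel₀ hζ.ne', one_smul]
  obtain ⟨J, hJr, hJ⟩ := bk_decomp n e he
  have hJo : ∀ y, ⟪J y, e⟫ = 0 := by
    intro y
    have : J y ∈ Set.range J := mem_range_self y
    rw [hJr] at this; exact this
  set K : EuclideanSpace ℝ (Fin (n+1)) → ℝ≥0∞ := fun σ => bkKer n s (γ + 2 * s + 1) r z σ with hK
  have hKm : Measurable K := (bkKer_measurable n s _ r).comp (measurable_const.prodMk measurable_id)
  let G : EuclideanSpace ℝ (Fin (n+1)) → ℝ≥0∞ := fun x =>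
    (Ioo (1:ℝ) 2).indicator (fun _ => (1:ℝ≥0∞)) ‖x‖ * K (‖x‖⁻¹ • x)
  have hGm : Measurable G := by
    refine Measurable.mul ?_ (hKm.comp (by fun_prop))
    exact (measurable_const.indicator measurableSet_Ioo).comp measurable_norm
  -- polar
  have hpol : ∫⁻ x, G x = (∫⁻ σ : sphere (0 : EuclideanSpace ℝ (Fin (n+1))) 1, K σ.1
        ∂((volume : Measure (EuclideanSpace ℝ (Fin (n+1)))).toSphere)) *
        ∫⁻ ρ in Ioi (0:ℝ), ENNReal.ofReal (ρ ^ n) * (Ioo (1:ℝ) 2).indicator (fun _ => (1:ℝ≥0∞)) ρ := by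
    rw [bk_polar_eq, ← bk_radial n (fun ρ => (Ioo (1:ℝ) 2).indicator (fun _ => (1:ℝ≥0∞)) ρ),
      ← lintegral_prod_mul]
    · refine lintegral_congr fun p => ?_
      obtain ⟨σ, ρ⟩ := p
      have hρ : 0 < ρ.1 := ρ.2
      have hσ : ‖σ.1‖ = 1 := by simp
      have hnn : ‖ρ.1 • σ.1‖ = ρ.1 := by rw [norm_smul, hσ, mul_one, Real.norm_of_nonneg hρ.le]
      simp only [G, hnn]
      rw [smul_smul, inv_mul_cancel₀ hρ.ne', one_smul, mul_comm]
    · exact (hKm.comp measurable_subtype_coe).aemeasurable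
    · exact ((measurable_const.indicator measurableSet_Ioo).comp measurable_subtype_coe).aemeasurable
  have hone : (1:ℝ≥0∞) ≤ ∫⁻ ρ in Ioi (0:ℝ), ENNReal.ofReal (ρ ^ n) * (Ioo (1:ℝ) 2).indicator (fun _ => (1:ℝ≥0∞)) ρ := by
    calc (1:ℝ≥0∞) = ∫⁻ ρ in Ioo (1:ℝ) 2, 1 := by simp; norm_num
      _ ≤ ∫⁻ ρ in Ioo (1:ℝ) 2, ENNReal.ofReal (ρ ^ n) * (Ioo (1:ℝ) 2).indicator (fun _ => (1:ℝ≥0∞)) ρ := by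
          refine setLIntegral_mono' measurableSet_Ioo fun ρ hρ => ?_
          rw [indicator_of_mem hρ, mul_one, ENNReal.one_le_ofReal]
          exact one_le_pow₀ hρ.1.le
      _ ≤ _ := lintegral_mono_set (fun ρ hρ => lt_trans one_pos hρ.1)
  have hA : ∫⁻ σ : sphere (0 : EuclideanSpace ℝ (Fin (n+1))) 1, K σ.1
        ∂((volume : Measure (EuclideanSpace ℝ (Fin (n+1)))).toSphere) ≤ ∫⁻ x, G x := by
    rw [hpol]; exact le_mul_of_one_le_right (zero_le) hone
  refine hA.trans ?_
  rw [hJ G hGm]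
  have hind : ∀ y : EuclideanSpace ℝ (Fin n),
      (if ‖y‖ < 2 then ENNReal.ofReal (‖y‖ ^ (γ + 2 * s + 1)) else 0) =
      (ball (0 : EuclideanSpace ℝ (Fin n)) 2).indicator (fun y => ENNReal.ofReal (‖y‖ ^ (γ + 2 * s + 1))) y := by
    intro y
    by_cases hy : ‖y‖ < 2
    · rw [if_pos hy, indicator_of_mem (by simpa using hy)]
    · rw [if_neg hy, indicator_of_notMem (by simpa using hy)]
  have hm1 : Measurable fun y : EuclideanSpace ℝ (Fin n) => ENNReal.ofReal (‖y‖ ^ (γ + 2 * s + 1)) :=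
    (measurable_norm.pow_const _).ennreal_ofReal
  have hm2 : Measurable fun t : ℝ => ENNReal.ofReal (t ^ (-1 - 2 * s)) :=
    (measurable_id.pow_const _).ennreal_ofReal
  calc ∫⁻ t : ℝ, ∫⁻ y, G (t • e + J y)
      ≤ ∫⁻ t : ℝ, ∫⁻ y, ENNReal.ofReal (2 ^ |γ| * ‖z‖ ^ γ) *
        ((Ici (r / ‖z‖)).indicator (fun t => ENNReal.ofReal (t ^ (-1 - 2 * s))) t *
          (ball (0 : EuclideanSpace ℝ (Fin n)) 2).indicator (fun y => ENNReal.ofReal (‖y‖ ^ (γ + 2 * s + 1))) y) := by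
        refine lintegral_mono fun t => lintegral_mono fun y => ?_
        by_cases hx : ‖t • e + J y‖ ∈ Ioo (1:ℝ) 2
        · simp only [G, indicator_of_mem hx, one_mul]
          have := bk_pointwise n s γ r ‖z‖ t hr hζ e (J y) he (hJo y) hx.1 hx.2
          rw [← hze, J.norm_map, hind] at this
          exact this
        · simp only [G, indicator_of_notMem hx, zero_mul]; exact zero_le
    _ = ENNReal.ofReal (2 ^ |γ| * ‖z‖ ^ γ) * (ENNReal.ofReal ((r / ‖z‖) ^ (-(2*s)) / (2*s)) * M) := by
        have hmi := hm1.indicator (measurableSet_ball (x := (0 : EuclideanSpace ℝ (Fin n))) (ε := 2))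
        have : ∀ t : ℝ, ∫⁻ y, ENNReal.ofReal (2 ^ |γ| * ‖z‖ ^ γ) *
            ((Ici (r / ‖z‖)).indicator (fun t => ENNReal.ofReal (t ^ (-1 - 2 * s))) t *
          (ball (0 : EuclideanSpace ℝ (Fin n)) 2).indicator (fun y => ENNReal.ofReal (‖y‖ ^ (γ + 2 * s + 1))) y)
          = ENNReal.ofReal (2 ^ |γ| * ‖z‖ ^ γ) *
            ((Ici (r / ‖z‖)).indicator (fun t => ENNReal.ofReal (t ^ (-1 - 2 * s))) t * M) := by
          intro t
          rw [lintegral_const_mul _ (hmi.const_mul _), lintegral_const_mul _ hmi,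
            lintegral_indicator measurableSet_ball]
        rw [lintegral_congr this]
        have hmt := hm2.indicator (measurableSet_Ici (a := r / ‖z‖))
        rw [lintegral_const_mul _ (hmt.mul_const _), lintegral_mul_const _ hmt,
          lintegral_indicator measurableSet_Ici, bk_tail s _ hs (by positivity)]
    _ = _ := by
        rw [← mul_assoc, mul_right_comm _ M, ← ENNReal.ofReal_mul (by positivity),
          ← ENNReal.ofReal_mul (by positivity)]
        congr 2
        rw [Real.div_rpow hr.le hζ.le, Real.rpow_add hζ, Real.rpow_neg hζ.le]
        have : 0 < ‖z‖ ^ (2 * s) := by positivity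
        field_simp

lemma bk_main (n : ℕ) (hn : 1 ≤ n) (s γ : ℝ) (hs : 0 < s)
    (hβ : -(n:ℝ) < γ + 2 * s + 1) :
    ∃ C : ℝ≥0∞, C ≠ ∞ ∧ ∀ (f : EuclideanSpace ℝ (Fin (n+1)) → ℝ≥0∞), Measurable f →
      ∀ (v' : EuclideanSpace ℝ (Fin (n+1))) (r : ℝ), 0 < r →
        (∫⁻ v in (Metric.ball v' r)ᶜ,
            ENNReal.ofReal (‖v - v'‖ ^ (-((n:ℝ)+1) - 2 * s)) *
              ∫⁻ w in {w : EuclideanSpace ℝ (Fin (n+1)) | ⟪w, v' - v⟫ = 0},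
                f (v + w) * ENNReal.ofReal (‖w‖ ^ (γ + 2 * s + 1))
                ∂(μH[(n : ℝ)]))
          ≤ C * ENNReal.ofReal (r ^ (-(2 * s))) *
              ∫⁻ z, f z * ENNReal.ofReal (‖z - v'‖ ^ (γ + 2 * s)) := by
  obtain ⟨c, hc, hH⟩ := bk_hausdorff n
  obtain ⟨C, hC, hang⟩ := bk_angular n hn s γ hs hβ
  refine ⟨c * C, ENNReal.mul_ne_top hc hC, ?_⟩
  intro f hf v' r hr
  set β := γ + 2 * s + 1 with hβd
  let μS := (volume : Measure (EuclideanSpace ℝ (Fin (n+1)))).toSphere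
  let H : EuclideanSpace ℝ (Fin (n+1)) → ℝ≥0∞ := fun u =>
    if r ≤ ‖u‖ then ENNReal.ofReal (‖u‖ ^ (-((n:ℝ)+1) - 2 * s)) *
              ∫⁻ w in {w : EuclideanSpace ℝ (Fin (n+1)) | ⟪w, u⟫ = 0},
                f (u + v' + w) * ENNReal.ofReal (‖w‖ ^ β) ∂(μH[(n : ℝ)]) else 0
  have hfm : ∀ a : EuclideanSpace ℝ (Fin (n+1)), Measurable fun z => f (z + a) :=
    fun a => hf.comp (measurable_add_const a)
  have step1 : (∫⁻ v in (Metric.ball v' r)ᶜ,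
            ENNReal.ofReal (‖v - v'‖ ^ (-((n:ℝ)+1) - 2 * s)) *
              ∫⁻ w in {w : EuclideanSpace ℝ (Fin (n+1)) | ⟪w, v' - v⟫ = 0},
                f (v + w) * ENNReal.ofReal (‖w‖ ^ β) ∂(μH[(n : ℝ)])) = ∫⁻ u, H u := by
    rw [← lintegral_indicator measurableSet_ball.compl, ← lintegral_add_right_eq_self _ v']
    refine lintegral_congr fun u => ?_
    have hset : {w : EuclideanSpace ℝ (Fin (n+1)) | ⟪w, v' - (u + v')⟫ = 0} = {w | ⟪w, u⟫ = 0} := by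
      ext w
      have : v' - (u + v') = -u := by abel
      simp [this, inner_neg_right]
    by_cases hu : r ≤ ‖u‖
    · rw [indicator_of_mem (by simpa [dist_eq_norm] using hu)]
      simp only [H, if_pos hu, add_sub_cancel_right, hset]
    · rw [indicator_of_notMem (by simpa [dist_eq_norm] using hu)]
      simp only [H, if_neg hu]
  -- for fixed direction
  have step2 : ∀ σ : sphere (0 : EuclideanSpace ℝ (Fin (n+1))) 1,
      ∫⁻ ρ in Ioi (0:ℝ), ENNReal.ofReal (ρ ^ n) * H (ρ • σ.1) ≤
        c * ∫⁻ z, f (z + v') * bkKer n s β r z σ.1 := by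
    intro σ
    have hσ : ‖σ.1‖ = 1 := by simp
    obtain ⟨J, hJr, hJ⟩ := bk_decomp n σ.1 hσ
    have hJo : ∀ y, ⟪J y, σ.1⟫ = 0 := by
      intro y
      have : J y ∈ Set.range J := mem_range_self y
      rw [hJr] at this; exact this
    have hGm : Measurable fun z => f (z + v') * bkKer n s β r z σ.1 :=
      (hfm v').mul ((bkKer_measurable n s β r).comp (measurable_id.prodMk measurable_const))
    rw [hJ _ hGm]
    have hmeas : Measurable fun t : ℝ => ∫⁻ y, f (t • σ.1 + J y + v') * bkKer n s β r (t • σ.1 + J y) σ.1 := by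
      refine Measurable.lintegral_prod_right' (f := fun p : ℝ × EuclideanSpace ℝ (Fin n) =>
        f (p.1 • σ.1 + J p.2 + v') * bkKer n s β r (p.1 • σ.1 + J p.2) σ.1) ?_
      refine hGm.comp (Continuous.measurable ?_)
      have := J.continuous
      fun_prop
    rw [← lintegral_const_mul _ hmeas]
    refine le_trans ?_ (setLIntegral_le_lintegral (Ioi (0:ℝ)) _)
    refine setLIntegral_mono' measurableSet_Ioi fun ρ hρ => ?_
    have hρ : 0 < ρ := hρ
    have hnn : ‖ρ • σ.1‖ = ρ := by rw [norm_smul, hσ, mul_one, Real.norm_of_nonneg hρ.le]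
    have hin : ∀ y, ⟪ρ • σ.1 + J y, σ.1⟫ = ρ := by
      intro y
      rw [inner_add_left, hJo, inner_smul_left, real_inner_self_eq_norm_sq, hσ]; simp
    have hsub : ∀ y, ‖ρ • σ.1 + J y - ρ • σ.1‖ = ‖y‖ := by
      intro y; rw [add_sub_cancel_left, J.norm_map]
    simp only [H, hnn, bkKer, hin, hsub]
    split_ifs with hrρ
    · have hset : {w : EuclideanSpace ℝ (Fin (n+1)) | ⟪w, ρ • σ.1⟫ = 0} = {w | ⟪w, σ.1⟫ = 0} := by
        ext w
        simp [inner_smul_right, hρ.ne']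
      rw [hset, hH σ.1 J hJr]
      simp only [J.norm_map]
      have hyy : Measurable fun y => f (ρ • σ.1 + v' + J y) * ENNReal.ofReal (‖y‖ ^ β) := by
        refine Measurable.mul (hf.comp (Continuous.measurable ?_))
          (measurable_norm.pow_const _).ennreal_ofReal
        have := J.continuous
        fun_prop
      have e1 : ∀ y, f (ρ • σ.1 + J y + v') * (ENNReal.ofReal (ρ ^ (-1 - 2 * s)) * ENNReal.ofReal (‖y‖ ^ β))
          = ENNReal.ofReal (ρ ^ (-1 - 2 * s)) * (f (ρ • σ.1 + v' + J y) * ENNReal.ofReal (‖y‖ ^ β)) := by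
        intro y
        rw [add_right_comm]; ring
      rw [lintegral_congr e1, lintegral_const_mul _ hyy]
      have e2 : ENNReal.ofReal (ρ ^ (-1 - 2 * s)) =
          ENNReal.ofReal (ρ ^ n) * ENNReal.ofReal (ρ ^ (-((n:ℝ)+1) - 2 * s)) := by
        rw [← ENNReal.ofReal_mul (by positivity), ← Real.rpow_natCast, ← Real.rpow_add hρ]
        congr 2; ring
      rw [e2]
      exact le_of_eq (by ring)
    · simp
  have hjoint : Measurable fun p : sphere (0 : EuclideanSpace ℝ (Fin (n+1))) 1 × EuclideanSpace ℝ (Fin (n+1)) =>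
      f (p.2 + v') * bkKer n s β r p.2 p.1.1 := by
    refine Measurable.mul ((hfm v').comp measurable_snd) ?_
    exact (bkKer_measurable n s β r).comp
      (measurable_snd.prodMk (measurable_subtype_coe.comp measurable_fst))
  have hkz : ∀ z, Measurable fun σ : sphere (0 : EuclideanSpace ℝ (Fin (n+1))) 1 => bkKer n s β r z σ.1 :=
    fun z => (bkKer_measurable n s β r).comp (measurable_const.prodMk measurable_subtype_coe)
  rw [step1]
  calc ∫⁻ u, H u ≤ ∫⁻ σ, (∫⁻ ρ : Ioi (0:ℝ), H (ρ.1 • σ.1) ∂(Measure.volumeIoiPow n)) ∂μS := by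
        rw [bk_polar_eq]; exact lintegral_prod_le _
    _ = ∫⁻ σ, (∫⁻ ρ in Ioi (0:ℝ), ENNReal.ofReal (ρ ^ n) * H (ρ • σ.1)) ∂μS :=
        lintegral_congr fun σ => bk_radial n (fun ρ => H (ρ • σ.1))
    _ ≤ ∫⁻ σ, c * (∫⁻ z, f (z + v') * bkKer n s β r z σ.1) ∂μS := lintegral_mono step2
    _ = c * ∫⁻ σ, (∫⁻ z, f (z + v') * bkKer n s β r z σ.1) ∂μS :=
        lintegral_const_mul _ hjoint.lintegral_prod_right'
    _ = c * ∫⁻ z, ∫⁻ σ, f (z + v') * bkKer n s β r z σ.1 ∂μS := by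
        rw [lintegral_lintegral_swap hjoint.aemeasurable]
    _ ≤ c * ∫⁻ z, C * ENNReal.ofReal (r ^ (-(2 * s))) *
          (f (z + v') * ENNReal.ofReal (‖z‖ ^ (γ + 2 * s))) := by
        gcongr with z
        rw [lintegral_const_mul _ (hkz z)]
        refine (mul_le_mul_right (hang r hr z) _).trans (le_of_eq ?_)
        rw [ENNReal.ofReal_mul (by positivity)]; ring
    _ = _ := by
        have hmz : Measurable fun z => f (z + v') * ENNReal.ofReal (‖z‖ ^ (γ + 2 * s)) :=
          (hfm v').mul (measurable_norm.pow_const _).ennreal_ofReal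
        rw [lintegral_const_mul _ hmz,
          ← lintegral_add_right_eq_self (fun z => f z * ENNReal.ofReal (‖z - v'‖ ^ (γ + 2 * s))) v']
        simp only [add_sub_cancel_right]
        ring

/-- **Tail upper bound for Boltzmann-type kernels.** For `d ≥ 2`, `s ∈ (0,1)` and
`γ ∈ (-d, 1]` with `γ + 2s ≤ 2`, there is a constant `C`, depending only on `d`, `s` and
`γ`, such that for every measurable `f : ℝ^d → [0,∞]`, every `v'` and every `r > 0`, the
kernel `K(v,v') = |v-v'|^{-d-2s} ∫_{(v'-v)^⊥} f(v+w) |w|^{γ+2s+1} dH(w)` satisfies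
`∫_{ℝ^d ∖ B_r(v')} K(v,v') dv ≤ C r^{-2s} ∫ f(z) |z - v'|^{γ+2s} dz` in `[0,∞]`. -/
theorem boltzmann_kernel_tail_bound (d : ℕ) (hd : 2 ≤ d) (s γ : ℝ)
    (hs : s ∈ Set.Ioo (0 : ℝ) 1) (hγl : -(d : ℝ) < γ) (hγu : γ ≤ 1)
    (hγs : γ + 2 * s ≤ 2) :
    ∃ C : ℝ, 0 < C ∧
      ∀ (f : EuclideanSpace ℝ (Fin d) → ℝ≥0∞), Measurable f →
      ∀ (v' : EuclideanSpace ℝ (Fin d)) (r : ℝ), 0 < r →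
        (∫⁻ v in (Metric.ball v' r)ᶜ,
            ENNReal.ofReal (‖v - v'‖ ^ (-(d : ℝ) - 2 * s)) *
              ∫⁻ w in {w : EuclideanSpace ℝ (Fin d) | ⟪w, v' - v⟫ = 0},
                f (v + w) * ENNReal.ofReal (‖w‖ ^ (γ + 2 * s + 1))
                ∂(μH[(d : ℝ) - 1]))
          ≤ ENNReal.ofReal (C * r ^ (-(2 * s))) *
              ∫⁻ z, f z * ENNReal.ofReal (‖z - v'‖ ^ (γ + 2 * s)) := by
  obtain ⟨n, rfl⟩ : ∃ n, d = n + 1 := ⟨d - 1, by omega⟩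
  obtain ⟨C, hC, h⟩ := bk_main n (by omega) s γ hs.1 (by push_cast at hγl; linarith [hs.1])
  refine ⟨C.toReal + 1, by positivity, ?_⟩
  intro f hf v' r hr
  have h1 := h f hf v' r hr
  have e : ((n + 1 : ℕ) : ℝ) - 1 = n := by push_cast; ring
  rw [e, Nat.cast_add, Nat.cast_one]
  refine h1.trans (mul_le_mul_left ?_ _)
  rw [ENNReal.ofReal_mul (by positivity)]
  refine mul_le_mul_left ?_ _
  rw [← ENNReal.ofReal_toReal hC]
  exact ENNReal.ofReal_le_ofReal (by simp)
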